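/- If σ(n) ≤ H_n + exp(H_n)·log(H_n) holds for every superabundant positive integer n, then σ(n) ≤ H_n + exp(H_n)·log(H_n) holds for every positive integer n. -/

import Mathlib

open Real Finset

/-- The n-th harmonic number `H_n = ∑_{j=1}^n 1/j` as a real number. -/
noncomputable def harmonicNum (n : ℕ) : ℝ := ∑ j ∈ Finset.range n, (1 : ℝ) / (j + 1)

/-- The sum-of-divisors function `σ(n) = ∑_{d ∣ n} d`. -/
def sigmaSum (n : ℕ) : ℕ := ∑ d ∈ Nat.divisors n, d

/-- A positive integer `n` is superabundant if `σ(m)/m < σ(n)/n` for every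
positive integer `m < n`. -/
def Superabundant (n : ℕ) : Prop :=
  0 < n ∧ ∀ m : ℕ, 0 < m → m < n →
    (sigmaSum m : ℝ) / m < (sigmaSum n : ℝ) / n

/-- The Lagarias inequality at `n`: `σ(n) ≤ H_n + exp(H_n)·log(H_n)`. -/
def LagariasIneq (n : ℕ) : Prop :=
  (sigmaSum n : ℝ) ≤ harmonicNum n + Real.exp (harmonicNum n) * Real.log (harmonicNum n)

lemma harmonicNum_succ (n : ℕ) : harmonicNum (n + 1) = harmonicNum n + 1 / ((n : ℝ) + 1) :=
  Finset.sum_range_succ _ _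

lemma one_le_harmonicNum {n : ℕ} (hn : 1 ≤ n) : 1 ≤ harmonicNum n := by
  induction n, hn using Nat.le_induction with
  | base => norm_num [harmonicNum]
  | succ n _ ih =>
    rw [harmonicNum_succ]
    have : 0 ≤ 1 / ((n : ℝ) + 1) := by positivity
    linarith

lemma add_one_le_exp_harmonicNum (n : ℕ) : (n : ℝ) + 1 ≤ Real.exp (harmonicNum n) := by
  induction n with
  | zero => simp [harmonicNum]
  | succ n ih =>
    rw [harmonicNum_succ, Real.exp_add]
    calc ((n + 1 : ℕ) : ℝ) + 1 = ((n : ℝ) + 1) * (1 / ((n : ℝ) + 1) + 1) := by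
          push_cast; field_simp; ring
      _ ≤ _ := by gcongr; exact Real.add_one_le_exp _

lemma harmonicNum_five : harmonicNum 5 = 137 / 60 := by
  norm_num [harmonicNum, Finset.sum_range_succ]

lemma harmonicNum_le_linear {n : ℕ} (hn : 5 ≤ n) : harmonicNum n ≤ n / 3 + 3 / 4 := by
  induction n, hn using Nat.le_induction with
  | base => norm_num [harmonicNum_five]
  | succ n hn ih =>
    have hn' : (5 : ℝ) ≤ n := by exact_mod_cast hn
    have : 1 / ((n : ℝ) + 1) ≤ 1 / 3 := one_div_le_one_div_of_le (by norm_num) (by linarith)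
    rw [harmonicNum_succ]
    push_cast
    linarith

lemma harmonicNum_sq_sub_le {n : ℕ} (hn : 5 ≤ n) :
    harmonicNum n ^ 2 - harmonicNum n ≤ 2 * n / 3 - 2 / 5 := by
  induction n, hn using Nat.le_induction with
  | base => norm_num [harmonicNum_five]
  | succ n hn ih =>
    have hlin := harmonicNum_le_linear hn
    have hn' : (5 : ℝ) ≤ n := by exact_mod_cast hn
    rw [harmonicNum_succ]
    set d := 1 / ((n : ℝ) + 1) with hd
    have hd0 : 0 < d := by positivity
    have hdn : d * (n + 1) = 1 := by rw [hd]; field_simp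
    have hd6 : d ≤ 1 / 6 := one_div_le_one_div_of_le (by norm_num) (by linarith)
    push_cast
    nlinarith [mul_le_mul_of_nonneg_left hlin hd0.le, mul_le_mul_of_nonneg_left hd6 hd0.le]

lemma harmonicNum_quadratic_bound {n : ℕ} (hn : 2 ≤ n) :
    (3 / 2 + 1 / (2 * (n : ℝ))) * (harmonicNum n ^ 2 - harmonicNum n)
      + ((n : ℝ) + 1) / (2 * (n : ℝ) ^ 2) ≤ n := by
  rcases (by omega : n = 2 ∨ n = 3 ∨ n = 4 ∨ 5 ≤ n) with rfl | rfl | rfl | h5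
  · norm_num [harmonicNum, Finset.sum_range_succ]
  · norm_num [harmonicNum, Finset.sum_range_succ]
  · norm_num [harmonicNum, Finset.sum_range_succ]
  · have hn' : (5 : ℝ) ≤ n := by exact_mod_cast h5
    have hn0 : (0 : ℝ) < n := by linarith
    calc _ ≤ (3 / 2 + 1 / (2 * (n : ℝ))) * (2 * n / 3 - 2 / 5)
            + ((n : ℝ) + 1) / (2 * (n : ℝ) ^ 2) := by
          gcongr _ * ?_ + _
          exact harmonicNum_sq_sub_le h5
      _ ≤ n := by
          rw [← sub_nonneg]
          have : (n : ℝ) - ((3 / 2 + 1 / (2 * (n : ℝ))) * (2 * n / 3 - 2 / 5)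
              + ((n : ℝ) + 1) / (2 * (n : ℝ) ^ 2))
              = (8 * (n : ℝ) ^ 2 - 9 * n - 15) / (30 * (n : ℝ) ^ 2) := by
            field_simp; ring
          rw [this]
          apply div_nonneg <;> nlinarith

/-- One step of the monotonicity of `(H + exp H * log H) / N`, for an abstract `H`. -/
lemma add_exp_mul_log_step {N H : ℝ} (hN : 2 ≤ N) (hH : 1 ≤ H) (hE : N ≤ Real.exp H)
    (hK : (3 / 2 + 1 / (2 * N)) * ((H + 1 / N) ^ 2 - (H + 1 / N))
      + (N + 1) / (2 * N ^ 2) ≤ N) :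
    N * (H + Real.exp H * Real.log H) ≤
      (N - 1) * (H + 1 / N + Real.exp (H + 1 / N) * Real.log (H + 1 / N)) := by
  have hN0 : 0 < N := by linarith
  have hd0 : 0 < 1 / N := by positivity
  set K := H + 1 / N with hKdef
  set c := (N + 1) / (2 * N ^ 2) with hc
  have hK1 : 1 ≤ K := by linarith
  have hK0 : 0 < K := by linarith
  have hc0 : 0 ≤ c := by positivity
  have hcN : c * N = 1 / 2 + 1 / (2 * N) := by rw [hc]; field_simp
  have hexp : N - c ≤ (N - 1) * Real.exp (1 / N) := by
    calc N - c = (N - 1) * (1 + 1 / N + (1 / N) ^ 2 / 2) := by rw [hc]; field_simp; ring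
      _ ≤ _ := by
        gcongr
        · linarith
        · exact Real.quadratic_le_exp_of_nonneg hd0.le
  have hL0 : 0 ≤ Real.log H := Real.log_nonneg hH
  have hL : Real.log H ≤ K - 1 := by linarith [Real.log_le_sub_one_of_pos (by linarith : 0 < H)]
  have hlogK : Real.log H + 1 / N / K ≤ Real.log K := by
    have h1 := Real.one_sub_inv_le_log_of_pos (div_pos hK0 (by linarith : 0 < H))
    rw [Real.log_div hK0.ne' (by linarith), inv_div] at h1
    have h2 : 1 - H / K = 1 / N / K := by
      rw [show H = K - 1 / N by rw [hKdef]; ring]; field_simp; ring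
    linarith
  have hT : (K - 1) / N ≤ (N - 1) * Real.exp (1 / N) * Real.log K - N * Real.log H := by
    have h1 : (N - c) * (Real.log H + 1 / N / K) ≤ (N - 1) * Real.exp (1 / N) * Real.log K := by
      apply mul_le_mul hexp hlogK (by positivity)
      exact mul_nonneg (by linarith) (Real.exp_pos _).le
    have h2 : c * Real.log H ≤ c * (K - 1) := by gcongr
    have h3 : (K - 1) / N ≤ (N - c) * (1 / N / K) - c * (K - 1) := by
      rw [← sub_nonneg]
      have : (N - c) * (1 / N / K) - c * (K - 1) - (K - 1) / N
          = (N - (K ^ 2 - K) - c - (c * N) * (K ^ 2 - K)) / (N * K) := by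
        field_simp; ring
      rw [this, hcN]
      apply div_nonneg _ (by positivity)
      linarith
    linarith
  have hET : K - 1 ≤ Real.exp H *
      ((N - 1) * Real.exp (1 / N) * Real.log K - N * Real.log H) := by
    calc K - 1 = N * ((K - 1) / N) := by field_simp
      _ ≤ _ := mul_le_mul hE hT (div_nonneg (by linarith) hN0.le) (Real.exp_pos _).le
  have hexpK : Real.exp K = Real.exp H * Real.exp (1 / N) := Real.exp_add _ _
  have hlin : N * H - (N - 1) * K = K - 1 := by rw [hKdef]; field_simp; ring
  rw [hexpK]
  linarith

lemma lagariasBound_div_le {m n : ℕ} (hm : 0 < m) (hmn : m ≤ n) :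
    (harmonicNum m + Real.exp (harmonicNum m) * Real.log (harmonicNum m)) / m ≤
      (harmonicNum n + Real.exp (harmonicNum n) * Real.log (harmonicNum n)) / n := by
  induction n, hmn using Nat.le_induction with
  | base => exact le_rfl
  | succ n hn ih =>
    refine ih.trans ?_
    have hn1 : 1 ≤ n := by omega
    have hn' : (1 : ℝ) ≤ n := by exact_mod_cast hn1
    have hK := harmonicNum_quadratic_bound (n := n + 1) (by omega)
    rw [harmonicNum_succ] at hK ⊢
    push_cast at hK ⊢
    have := add_exp_mul_log_step (by linarith) (one_le_harmonicNum hn1)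
      (add_one_le_exp_harmonicNum n) hK
    rw [div_le_div_iff₀ (by linarith) (by linarith)]
    linarith

/-- Every `n > 0` is dominated in `σ(n) / n` by a superabundant `m ≤ n`. -/
lemma exists_superabundant_le {n : ℕ} (hn : 0 < n) :
    ∃ m ≤ n, Superabundant m ∧ (sigmaSum n : ℝ) / n ≤ (sigmaSum m : ℝ) / m := by
  induction n using Nat.strong_induction_on with
  | _ n ih =>
    by_cases hs : Superabundant n
    · exact ⟨n, le_rfl, hs, le_rfl⟩
    · simp only [Superabundant, not_and, not_forall, not_lt] at hs
      obtain ⟨k, hk, hkn, hle⟩ := hs hn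
      obtain ⟨m, hmk, hm, hle'⟩ := ih k hkn hk
      exact ⟨m, hmk.trans hkn.le, hm, hle.trans hle'⟩

theorem lagarias_of_superabundant
    (h : ∀ n : ℕ, 0 < n → Superabundant n → LagariasIneq n) :
    ∀ n : ℕ, 0 < n → LagariasIneq n := by
  intro n hn
  obtain ⟨m, hmn, hm, hle⟩ := exists_superabundant_le hn
  have hm0 : (0 : ℝ) < m := by exact_mod_cast hm.1
  have hn0 : (0 : ℝ) < n := by exact_mod_cast hn
  exact (div_le_div_iff_of_pos_right hn0).mp <|
    hle.trans (((div_le_div_iff_of_pos_right hm0).mpr (h m hm.1 hm)).trans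
      (lagariasBound_div_le hm.1 hmn))
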